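/- arXiv:1810.06031 — 5 statements merged into one kernel-verified Lean document; each statement's English description precedes it below -/
import Mathlib

section
/- Let F be a field, n ≥ 1, and let x : Fin n → F be injective. Let V be the n×n matrix with entries V(l,r) = x(r)^l for l, r ∈ Fin n (so the rows are indexed by the exponents 0,…,n−1 and the columns by the points). Then V is invertible, and its inverse W is given explicitly by W(r,l) = (−1)^{n−1−l} · e_{n−1−l}({x(i) : i ≠ r}) / ∏_{i ≠ r}(x(r) − x(i)), where e_p denotes the elementary symmetric polynomial of degree p in the n−1 values x(i), i ≠ r. -/
open Polynomial in
/-- Evaluation of a product of linear factors `X - C a` over a finite multiset, expanded in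
elementary symmetric polynomials. -/
theorem Multiset.sum_esymm_mul_pow_eq_prod_sub {R : Type*} [CommRing R] [Nontrivial R]
    (s : Multiset R) (y : R) :
    ∑ l ∈ Finset.range (s.card + 1), (-1 : R) ^ (s.card - l) * s.esymm (s.card - l) * y ^ l =
      (s.map fun a => y - a).prod := by
  have hdeg : (s.map fun a => X - C a).prod.natDegree = s.card :=
    natDegree_multiset_prod_X_sub_C_eq_card s
  have heval : (s.map fun a => X - C a).prod.eval y = (s.map fun a => y - a).prod := by
    simp [eval_multiset_prod]
  rw [← heval, eval_eq_sum_range, hdeg]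
  refine Finset.sum_congr rfl fun l hl => ?_
  rw [s.prod_X_sub_C_coeff (Nat.lt_succ_iff.mp (Finset.mem_range.mp hl))]


/-- explicit inverse of the Vandermonde matrix `V l r = x r ^ l` at `n`
distinct points, in terms of elementary symmetric polynomials of the points. -/
theorem vandermonde_inverse
    (F : Type*) [Field F] (n : ℕ) (hn : 1 ≤ n)
    (x : Fin n → F) (hx : Function.Injective x)
    (V W : Matrix (Fin n) (Fin n) F)
    (hV : ∀ l r : Fin n, V l r = x r ^ (l : ℕ))
    (hW : ∀ r l : Fin n, W r l =
      (-1 : F) ^ (n - 1 - (l : ℕ)) *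
        (((Finset.univ.erase r).val.map x).esymm (n - 1 - (l : ℕ))) /
        ∏ i ∈ Finset.univ.erase r, (x r - x i)) :
    IsUnit V ∧ V⁻¹ = W := by
  have hWV : W * V = 1 := by
    ext r s
    have hcard : ((Finset.univ.erase r).val.map x).card = n - 1 := by simp
    have hsum := Multiset.sum_esymm_mul_pow_eq_prod_sub ((Finset.univ.erase r).val.map x) (x s)
    rw [hcard, Nat.sub_add_cancel hn, Multiset.map_map, ← Fin.sum_univ_eq_sum_range
      (fun l => (-1 : F) ^ (n - 1 - l) *
        ((Finset.univ.erase r).val.map x).esymm (n - 1 - l) * x s ^ l)] at hsum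
    have hentry : (W * V) r s =
        (∏ i ∈ Finset.univ.erase r, (x s - x i)) / ∏ i ∈ Finset.univ.erase r, (x r - x i) := by
      simp only [Matrix.mul_apply, hV, hW, div_mul_eq_mul_div]
      rw [← Finset.sum_div, hsum]
      rfl
    rw [hentry]
    obtain rfl | hrs := eq_or_ne r s
    · rw [Matrix.one_apply_eq, div_self]
      exact Finset.prod_ne_zero_iff.mpr fun i hi =>
        sub_ne_zero.mpr (hx.ne (Finset.ne_of_mem_erase hi).symm)
    · rw [Matrix.one_apply_ne hrs, Finset.prod_eq_zero
        (Finset.mem_erase.mpr ⟨hrs.symm, Finset.mem_univ s⟩) (sub_self _), zero_div]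
  exact ⟨(Matrix.isUnit_iff_isUnit_det V).mpr (Matrix.isUnit_det_of_left_inverse hWV),
    Matrix.inv_eq_left_inv hWV⟩
end

section
/- Let F be a field, n ≥ 1, let x : Fin n → F be injective, and let w : Fin n → F satisfy w(r) ≠ 0 for all r. Let A be the n×n matrix with entries A(l,r) = x(r)^l / w(r) for l, r ∈ Fin n. Then A is invertible, and its inverse is the matrix B with entries B(r,l) = w(r) · (−1)^{n−1−l} · e_{n−1−l}({x(i) : i ≠ r}) / ∏_{i ≠ r}(x(r) − x(i)), where e_p denotes the elementary symmetric polynomial of degree p in the n−1 values x(i), i ≠ r. -/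
/-- The value at `y` of the nodal polynomial `∏ i ≠ r, (X - x i)`, expanded in the
elementary symmetric polynomials of its roots. -/
theorem sum_esymm_erase_mul_pow {R : Type*} [CommRing R] [Nontrivial R] {n : ℕ}
    (x : Fin n → R) (r : Fin n) (y : R) :
    ∑ l : Fin n, (-1 : R) ^ (n - 1 - (l : ℕ)) *
        ((Finset.univ.erase r).val.map x).esymm (n - 1 - (l : ℕ)) * y ^ (l : ℕ) =
      ∏ i ∈ Finset.univ.erase r, (y - x i) := by
  have hcard : (Finset.univ.erase r).card = n - 1 := by simp
  have hdeg : (Lagrange.nodal (Finset.univ.erase r) x).natDegree < n := by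
    rw [Lagrange.natDegree_nodal, hcard]
    have := r.pos
    omega
  rw [← Lagrange.eval_nodal, Polynomial.eval_eq_sum_range' hdeg, Finset.sum_range]
  refine Finset.sum_congr rfl fun l _ => ?_
  have hcoeff := Multiset.prod_X_sub_C_coeff ((Finset.univ.erase r).val.map x) (k := (l : ℕ))
    (by rw [Multiset.card_map, Finset.card_val, hcard]; omega)
  rw [Multiset.card_map, Finset.card_val, hcard, Multiset.map_map] at hcoeff
  rw [← hcoeff]
  rfl

/-- explicit inverse of the weighted Vandermonde matrix
`A l r = x r ^ l / w r` at `n` distinct points with nonzero weights. -/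
theorem weighted_vandermonde_inverse
    (F : Type*) [Field F] (n : ℕ) (hn : 1 ≤ n)
    (x : Fin n → F) (hx : Function.Injective x)
    (w : Fin n → F) (hw : ∀ r : Fin n, w r ≠ 0)
    (A B : Matrix (Fin n) (Fin n) F)
    (hA : ∀ l r : Fin n, A l r = x r ^ (l : ℕ) / w r)
    (hB : ∀ r l : Fin n, B r l =
      w r * ((-1 : F) ^ (n - 1 - (l : ℕ)) *
        (((Finset.univ.erase r).val.map x).esymm (n - 1 - (l : ℕ)))) /
        ∏ i ∈ Finset.univ.erase r, (x r - x i)) :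
    IsUnit A ∧ A⁻¹ = B := by
  have hBA : B * A = 1 := by
    ext r s
    have hentry : (B * A) r s = w r / w s *
        ((∏ i ∈ Finset.univ.erase r, (x s - x i)) /
          ∏ i ∈ Finset.univ.erase r, (x r - x i)) := by
      rw [← sum_esymm_erase_mul_pow x r (x s), Matrix.mul_apply, Finset.sum_div, Finset.mul_sum]
      refine Finset.sum_congr rfl fun l _ => ?_
      rw [hA, hB]
      ring
    rw [hentry]
    obtain rfl | hrs := eq_or_ne r s
    · have hprod : ∏ i ∈ Finset.univ.erase r, (x r - x i) ≠ 0 :=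
        Finset.prod_ne_zero_iff.mpr fun i hi =>
          sub_ne_zero.mpr (hx.ne (Finset.ne_of_mem_erase hi).symm)
      rw [div_self (hw r), div_self hprod, one_mul, Matrix.one_apply_eq]
    · rw [Finset.prod_eq_zero (Finset.mem_erase.mpr ⟨hrs.symm, Finset.mem_univ s⟩)
        (sub_self (x s)), zero_div, mul_zero, Matrix.one_apply_ne hrs]
  exact ⟨IsUnit.of_mul_eq_one_right B hBA, Matrix.inv_eq_left_inv hBA⟩
end

section
/- Let R be a commutative ring, g ≥ 1, and λ : Fin g → R. Let M be the g×g matrix with entries M(k,l) = (−1)^{g−1−l} · e_{g−1−l}({λ(i) : i ≠ k}) for k, l ∈ Fin g, where e_p denotes the elementary symmetric polynomial of degree p in the g−1 values λ(i), i ≠ k. Then det M = ∏_{i<j}(λ(i) − λ(j)), the Vandermonde determinant of the λ's. -/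
open Polynomial in
/-- The matrix whose `k`-th row lists the coefficients of `∏ i ≠ k, (X - λ i)`. -/
noncomputable def nodalCoeffMatrix {R : Type*} [CommRing R] {g : ℕ} (lam : Fin g → R) :
    Matrix (Fin g) (Fin g) R :=
  Matrix.of fun k l => (∏ i ∈ Finset.univ.erase k, (X - C (lam i))).coeff l

theorem nodalCoeffMatrix_map {R S : Type*} [CommRing R] [CommRing S] (φ : R →+* S) {g : ℕ}
    (lam : Fin g → R) :
    nodalCoeffMatrix (fun i => φ (lam i)) = φ.mapMatrix (nodalCoeffMatrix lam) := by
  ext k l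
  simp [nodalCoeffMatrix, ← Polynomial.coeff_map, Polynomial.map_prod]

open Polynomial in
theorem nodalCoeffMatrix_mul_vandermonde_transpose {R : Type*} [CommRing R] {g : ℕ}
    (lam : Fin g → R) :
    nodalCoeffMatrix lam * (Matrix.vandermonde lam).transpose =
      Matrix.diagonal fun k => ∏ i ∈ Finset.univ.erase k, (lam k - lam i) := by
  ext k j
  have hdeg : (∏ i ∈ Finset.univ.erase k, (X - C (lam i))).natDegree < g := by
    refine (natDegree_prod_le _ _).trans_lt ?_
    refine (Finset.sum_le_sum fun i _ => natDegree_X_sub_C_le (lam i)).trans_lt ?_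
    have := k.pos
    simp [Finset.card_erase_of_mem]
    omega
  have heval := eval_eq_sum_range' hdeg (lam j)
  rw [Finset.sum_range] at heval
  simp only [Matrix.mul_apply, nodalCoeffMatrix, Matrix.of_apply, Matrix.transpose_apply,
    Matrix.vandermonde_apply]
  rw [← heval, eval_prod]
  simp only [eval_sub, eval_X, eval_C]
  rcases eq_or_ne k j with rfl | hkj
  · rw [Matrix.diagonal_apply_eq]
  · rw [Matrix.diagonal_apply_ne _ hkj]
    exact Finset.prod_eq_zero (Finset.mem_erase.2 ⟨hkj.symm, Finset.mem_univ j⟩) (sub_self _)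

theorem det_nodalCoeffMatrix_of_injective {R : Type*} [CommRing R] [IsDomain R] {g : ℕ}
    (lam : Fin g → R) (hlam : Function.Injective lam) :
    (nodalCoeffMatrix lam).det = ∏ i : Fin g, ∏ j ∈ Finset.Ioi i, (lam i - lam j) := by
  refine mul_right_cancel₀ (Matrix.det_vandermonde_ne_zero_iff.2 hlam) ?_
  rw [← Matrix.det_transpose (Matrix.vandermonde lam), ← Matrix.det_mul,
    nodalCoeffMatrix_mul_vandermonde_transpose, Matrix.det_diagonal, Matrix.det_transpose,
    Matrix.det_vandermonde]
  simp_rw [← Finset.prod_mul_distrib]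
  rw [Finset.prod_prod_Ioi_mul_eq_prod_prod_off_diag (fun j i => lam i - lam j)]
  simp [Finset.compl_singleton]

theorem det_nodalCoeffMatrix {R : Type*} [CommRing R] {g : ℕ} (lam : Fin g → R) :
    (nodalCoeffMatrix lam).det = ∏ i : Fin g, ∏ j ∈ Finset.Ioi i, (lam i - lam j) := by
  let φ : MvPolynomial (Fin g) ℤ →+* R := (MvPolynomial.aeval lam).toRingHom
  have hφ : (fun i => φ (MvPolynomial.X i)) = lam := by
    funext i
    simp [φ]
  have h := det_nodalCoeffMatrix_of_injective (R := MvPolynomial (Fin g) ℤ)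
    MvPolynomial.X (MvPolynomial.X_injective)
  have h' := congrArg φ h
  rw [RingHom.map_det, ← nodalCoeffMatrix_map, hφ] at h'
  rw [h', map_prod]
  simp_rw [map_prod, map_sub, fun i => congrFun hφ i]

/-- the matrix `M k l = (-1) ^ (g - 1 - l) * e_{g - 1 - l}(λ i, i ≠ k)`
has determinant equal to the Vandermonde determinant `∏_{i < j} (λ i - λ j)`. -/
theorem det_esymm_matrix_eq_vandermonde
    (R : Type*) [CommRing R] (g : ℕ) (hg : 1 ≤ g)
    (lam : Fin g → R)
    (M : Matrix (Fin g) (Fin g) R)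
    (hM : ∀ k l : Fin g, M k l =
      (-1 : R) ^ (g - 1 - (l : ℕ)) *
        (((Finset.univ.erase k).val.map lam).esymm (g - 1 - (l : ℕ)))) :
    M.det = ∏ i : Fin g, ∏ j ∈ Finset.Ioi i, (lam i - lam j) := by
  rw [← det_nodalCoeffMatrix]
  congr 1
  ext k l
  have hcard : Multiset.card ((Finset.univ.erase k).val.map lam) = g - 1 := by
    simp
  have h := Multiset.prod_X_sub_C_coeff ((Finset.univ.erase k).val.map lam) (k := l)
    (by rw [hcard]; omega)
  rw [hcard, Multiset.map_map] at h
  rw [hM]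
  exact h.symm
end

section
/- Let g ≥ 1, let τ be a symmetric g×g complex matrix, let ε, δ ∈ ℝ^g, let ζ ∈ ℂ^g, and let n, l ∈ ℤ^g. Then the quasi-periodicity relation θ[ε;δ](ζ + τn + l, τ) = e(−nᵀτn/2 − nᵀζ + (lᵀε − nᵀδ)/2)·θ[ε;δ](ζ,τ) holds, where e(α) = exp(2πiα) and τn denotes the matrix-vector product. -/
open scoped Real

/-- The Riemann theta function with characteristic `[ε; δ]`, defined as an unconditional
sum over `m : Fin g → ℤ` (interpreted as `0` if the family is not summable):
`θ[ε;δ](ζ,τ) = ∑_{m ∈ ℤ^g} e((m+ε/2)ᵀ(τ/2)(m+ε/2) + (m+ε/2)ᵀ(ζ+δ/2))`,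
where `e(α) = exp(2πiα)`. -/
noncomputable def riemannThetaChar (g : ℕ) (ε δ : Fin g → ℝ) (ζ : Fin g → ℂ)
    (τ : Matrix (Fin g) (Fin g) ℂ) : ℂ :=
  ∑' m : Fin g → ℤ,
    Complex.exp (2 * π * Complex.I *
      ((∑ i, ∑ j, ((m i : ℂ) + (ε i : ℂ) / 2) * (τ i j / 2) * ((m j : ℂ) + (ε j : ℂ) / 2)) +
        ∑ i, ((m i : ℂ) + (ε i : ℂ) / 2) * (ζ i + (δ i : ℂ) / 2)))

/-- Expansion of the quadratic form of a symmetric matrix at a sum of two vectors. -/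
theorem Matrix.IsSymm.sum_half_quadratic_add {ι : Type*} [Fintype ι] {τ : Matrix ι ι ℂ}
    (hτ : τ.IsSymm) (a b : ι → ℂ) :
    ∑ i, ∑ j, (a i + b i) * (τ i j / 2) * (a j + b j) =
      (∑ i, ∑ j, a i * (τ i j / 2) * a j) + (∑ i, a i * ∑ j, τ i j * b j) +
        (∑ i, ∑ j, b i * τ i j * b j) / 2 := by
  have hswap : ∑ i, ∑ j, b i * (τ i j / 2) * a j = ∑ i, ∑ j, a i * (τ i j / 2) * b j := by
    rw [Finset.sum_comm]
    refine Finset.sum_congr rfl fun i _ => Finset.sum_congr rfl fun j _ => ?_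
    rw [hτ.apply i j]
    ring
  calc ∑ i, ∑ j, (a i + b i) * (τ i j / 2) * (a j + b j)
      = (∑ i, ∑ j, a i * (τ i j / 2) * a j) + (∑ i, ∑ j, a i * (τ i j / 2) * b j) +
          (∑ i, ∑ j, b i * (τ i j / 2) * a j) + ∑ i, ∑ j, b i * (τ i j / 2) * b j := by
        simp only [← Finset.sum_add_distrib]
        refine Finset.sum_congr rfl fun i _ => Finset.sum_congr rfl fun j _ => ?_
        ring
    _ = _ := by
        rw [hswap]
        simp only [Finset.mul_sum, Finset.sum_div, ← Finset.sum_add_distrib]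
        refine Finset.sum_congr rfl fun i _ => Finset.sum_congr rfl fun j _ => ?_
        ring

/-- quasi-periodicity of the theta function with characteristic:
`θ[ε;δ](ζ + τn + l, τ) = e(-nᵀτn/2 - nᵀζ + (lᵀε - nᵀδ)/2) · θ[ε;δ](ζ,τ)`. -/
theorem riemannThetaChar_periodicity (g : ℕ) (hg : 1 ≤ g)
    (τ : Matrix (Fin g) (Fin g) ℂ) (hτ : τ.IsSymm)
    (ε δ : Fin g → ℝ) (ζ : Fin g → ℂ) (n l : Fin g → ℤ) :
    riemannThetaChar g ε δ
        (fun i => ζ i + (∑ j, τ i j * (n j : ℂ)) + (l i : ℂ)) τ =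
      Complex.exp (2 * π * Complex.I *
          (-(∑ i, ∑ j, (n i : ℂ) * τ i j * (n j : ℂ)) / 2 - ∑ i, (n i : ℂ) * ζ i +
            ((∑ i, (l i : ℂ) * (ε i : ℂ)) - ∑ i, (n i : ℂ) * (δ i : ℂ)) / 2)) *
        riemannThetaChar g ε δ ζ τ := by
  unfold riemannThetaChar
  rw [← tsum_mul_left]
  refine Eq.trans ?_ ((Equiv.addRight n).tsum_eq _)
  refine tsum_congr fun m => ?_
  rw [← Complex.exp_add, Complex.exp_eq_exp_iff_exists_int]
  refine ⟨∑ i, m i * l i, ?_⟩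
  have hshift : ∀ i, (((Equiv.addRight n) m i : ℤ) : ℂ) + (ε i : ℂ) / 2 =
      ((m i : ℂ) + (ε i : ℂ) / 2) + (n i : ℂ) := fun i => by
    simp only [Equiv.coe_addRight, Pi.add_apply, Int.cast_add]
    ring
  simp only [hshift]
  rw [hτ.sum_half_quadratic_add (fun i => (m i : ℂ) + (ε i : ℂ) / 2) (fun i => (n i : ℂ))]
  have hlin : ∑ i, ((m i : ℂ) + (ε i : ℂ) / 2) *
        (ζ i + (∑ j, τ i j * (n j : ℂ)) + (l i : ℂ) + (δ i : ℂ) / 2) =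
      (∑ i, ((m i : ℂ) + (ε i : ℂ) / 2) * ∑ j, τ i j * (n j : ℂ)) +
        (∑ i, ((m i : ℂ) + (ε i : ℂ) / 2 + (n i : ℂ)) * (ζ i + (δ i : ℂ) / 2)) -
        (∑ i, (n i : ℂ) * ζ i) - (∑ i, (n i : ℂ) * (δ i : ℂ)) / 2 +
        (∑ i, (l i : ℂ) * (ε i : ℂ)) / 2 + ∑ i, (m i : ℂ) * (l i : ℂ) := by
    simp only [Finset.sum_div, ← Finset.sum_add_distrib, ← Finset.sum_sub_distrib]
    refine Finset.sum_congr rfl fun i _ => ?_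
    ring
  rw [hlin]
  push_cast
  ring
end

section
/- Let g ≥ 1 and let τ be a symmetric g×g complex matrix whose entrywise imaginary part (the real g×g matrix with entries Im τ_{ij}) is positive definite. Then for every ζ ∈ ℂ^g and every ε, δ ∈ ℝ^g, the family of terms m ↦ e((m+ε/2)ᵀ(τ/2)(m+ε/2) + (m+ε/2)ᵀ(ζ+δ/2)), indexed by m : Fin g → ℤ, is (absolutely) summable, where e(α) = exp(2πiα). -/
open scoped Real

/-- A positive definite real quadratic form dominates a positive multiple of the sum of squares. -/
theorem Matrix.PosDef.exists_pos_mul_sum_sq_le {ι : Type*} [Fintype ι] {Y : Matrix ι ι ℝ}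
    (hY : Y.PosDef) : ∃ c > 0, ∀ x : ι → ℝ, c * ∑ i, x i ^ 2 ≤ ∑ i, ∑ j, x i * Y i j * x j := by
  have hpos : ∀ x : ι → ℝ, x ≠ 0 → 0 < ∑ i, ∑ j, x i * Y i j * x j := fun x hx ↦ by
    simpa [dotProduct, Matrix.mulVec, Finset.mul_sum, mul_assoc] using hY.dotProduct_mulVec_pos hx
  rcases isEmpty_or_nonempty ι with h | h
  · exact ⟨1, one_pos, fun x ↦ by simp⟩
  obtain ⟨u, hu, hmin⟩ := (isCompact_sphere (0 : ι → ℝ) 1).exists_isMinOn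
    (NormedSpace.sphere_nonempty.2 zero_le_one)
    (f := fun x ↦ ∑ i, ∑ j, x i * Y i j * x j) (by fun_prop)
  have hu0 : u ≠ 0 := by
    rintro rfl
    simp at hu
  set q := ∑ i, ∑ j, u i * Y i j * u j with hq
  have hcard : (0 : ℝ) < Fintype.card ι := by exact_mod_cast Fintype.card_pos
  refine ⟨q / Fintype.card ι, div_pos (hpos u hu0) hcard, fun x ↦ ?_⟩
  rcases eq_or_ne x 0 with rfl | hx
  · simp
  have hx' : 0 < ‖x‖ := norm_pos_iff.2 hx
  have hsphere : ‖x‖⁻¹ • x ∈ Metric.sphere (0 : ι → ℝ) 1 := by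
    simp [norm_smul, hx'.ne']
  have hle : q ≤ ‖x‖⁻¹ ^ 2 * ∑ i, ∑ j, x i * Y i j * x j := by
    have h₁ := hmin hsphere
    simp only [Set.mem_ofPred_eq, Pi.smul_apply, smul_eq_mul] at h₁
    rw [Finset.mul_sum]
    simp only [Finset.mul_sum]
    refine h₁.trans_eq ?_
    refine Finset.sum_congr rfl fun i _ ↦ Finset.sum_congr rfl fun j _ ↦ by ring
  have hsum : ∑ i, x i ^ 2 ≤ Fintype.card ι * ‖x‖ ^ 2 := by
    rw [← nsmul_eq_mul, ← Finset.card_univ]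
    refine Finset.sum_le_card_nsmul _ _ _ fun i _ ↦ ?_
    rw [← sq_abs]
    exact pow_le_pow_left₀ (abs_nonneg _) (norm_le_pi_norm x i) 2
  calc q / Fintype.card ι * ∑ i, x i ^ 2
      ≤ q / Fintype.card ι * (Fintype.card ι * ‖x‖ ^ 2) :=
        mul_le_mul_of_nonneg_left hsum (div_pos (hpos u hu0) hcard).le
    _ = q * ‖x‖ ^ 2 := by field_simp
    _ ≤ (‖x‖⁻¹ ^ 2 * ∑ i, ∑ j, x i * Y i j * x j) * ‖x‖ ^ 2 := by gcongr
    _ = _ := by field_simp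

/-- A finite product of nonnegative summable families in separate variables is summable. -/
theorem summable_pi_prod_of_nonneg {α : Type*} {n : ℕ} {f : Fin n → α → ℝ}
    (hf : ∀ i, Summable (f i)) (hf₀ : ∀ i a, 0 ≤ f i a) :
    Summable fun m : Fin n → α ↦ ∏ i, f i (m i) := by
  induction n with
  | zero => exact Summable.of_finite
  | succ n ih =>
    rw [← (Fin.consEquiv fun _ : Fin (n + 1) ↦ α).summable_iff]
    refine ((hf 0).mul_of_nonneg (ih (fun i ↦ hf i.succ) fun i ↦ hf₀ i.succ) (hf₀ 0)
      fun m ↦ Finset.prod_nonneg fun i _ ↦ hf₀ _ _).congr fun p ↦ ?_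
    simp [Fin.prod_univ_succ]

/-- A shifted Gaussian with a linear term is summable over the integers. -/
theorem summable_int_exp_neg_sq_sub_linear {c : ℝ} (hc : 0 < c) (e b : ℝ) :
    Summable fun n : ℤ ↦ Real.exp (-π * (c * (n + e) ^ 2 + 2 * b * (n + e))) := by
  refine ((summable_pow_mul_jacobiTheta₂_term_bound |c * e + b| hc 0).mul_left
    (Real.exp (-π * (c * e ^ 2 + 2 * b * e)))).of_nonneg_of_le (fun _ ↦ (Real.exp_pos _).le)
    fun n ↦ ?_
  rw [pow_zero, one_mul, ← Real.exp_add, Real.exp_le_exp]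
  have h : -((c * e + b) * n) ≤ |c * e + b| * |(n : ℝ)| := by
    rw [← abs_mul]
    exact neg_le_abs _
  push_cast
  nlinarith [mul_le_mul_of_nonneg_left h Real.pi_pos.le]

/-- for `τ` in the Siegel upper half-space (symmetric with positive
definite imaginary part) the defining series of the theta function with characteristic
is summable. -/
theorem riemannThetaChar_summable (g : ℕ) (hg : 1 ≤ g)
    (τ : Matrix (Fin g) (Fin g) ℂ) (hτ : τ.IsSymm)
    (hτ' : (Matrix.of fun i j => (τ i j).im).PosDef)
    (ζ : Fin g → ℂ) (ε δ : Fin g → ℝ) :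
    Summable (fun m : Fin g → ℤ =>
      Complex.exp (2 * π * Complex.I *
        ((∑ i, ∑ j, ((m i : ℂ) + (ε i : ℂ) / 2) * (τ i j / 2) * ((m j : ℂ) + (ε j : ℂ) / 2)) +
          ∑ i, ((m i : ℂ) + (ε i : ℂ) / 2) * (ζ i + (δ i : ℂ) / 2)))) := by
  obtain ⟨c, hc, hcoer⟩ := hτ'.exists_pos_mul_sum_sq_le
  refine (summable_pi_prod_of_nonneg
    (fun i ↦ summable_int_exp_neg_sq_sub_linear hc (ε i / 2) (ζ i).im)
    fun _ _ ↦ (Real.exp_pos _).le).of_norm_bounded fun m ↦ ?_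
  rw [Complex.norm_exp, ← Real.exp_sum, Real.exp_le_exp, ← Finset.mul_sum, Finset.sum_add_distrib,
    ← Finset.mul_sum]
  set x : Fin g → ℝ := fun i ↦ m i + ε i / 2 with hx
  have hxc : ∀ i, (m i : ℂ) + (ε i : ℂ) / 2 = (x i : ℂ) := fun i ↦ by simp [hx]
  have hquad : (∑ i, ∑ j, (x i : ℂ) * (τ i j / 2) * (x j : ℂ)).im
      = (∑ i, ∑ j, x i * (τ i j).im * x j) / 2 := by
    simp only [Complex.im_sum, Finset.sum_div]
    refine Finset.sum_congr rfl fun i _ ↦ Finset.sum_congr rfl fun j _ ↦ ?_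
    simp
    ring
  have hlin : (∑ i, (x i : ℂ) * (ζ i + (δ i : ℂ) / 2)).im = ∑ i, x i * (ζ i).im := by
    simp [Complex.im_sum]
  have hlin' : ∑ i, 2 * (ζ i).im * x i = 2 * ∑ i, x i * (ζ i).im := by
    rw [Finset.mul_sum]
    exact Finset.sum_congr rfl fun i _ ↦ by ring
  have hre : ∀ w : ℂ, (2 * π * Complex.I * w).re = -(2 * π * w.im) := fun w ↦ by simp
  simp only [hxc]
  rw [hre, Complex.add_im, hquad, hlin]
  have hcx := mul_le_mul_of_nonneg_left (hcoer x) Real.pi_pos.le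
  simp only [Matrix.of_apply] at hcx
  change _ ≤ -π * (c * ∑ i, x i ^ 2 + ∑ i, 2 * (ζ i).im * x i)
  rw [hlin']
  linarith
end
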